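/- arXiv:2409.18537 — 2 statements merged into one kernel-verified Lean document; each statement's English description precedes it below -/
import Mathlib

section
/- Let δ ∈ (0,1), and let u ≥ 1, v ≥ 0, w ≥ 1, H ≥ 3 be real numbers. Let N ≥ 2 be an integer such that (N−1)^{N−1} < (2uH)^{1/δ} · w^{(N−1)/δ} · (N−1)^{v/δ}. Then N ≤ 1 + w^{4/δ} + 2v/δ + 8·ln(2uH) / (δ · ln(ln((2uH)^{4/δ}))). -/
theorem lt_mul_log_of_two_mul_div_log_lt {M x : ℝ} (hM : 1 < M)
    (hx : 2 * M / Real.log M < x) : M < x * Real.log x := by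
  obtain ⟨s, hs, rfl⟩ : ∃ s : ℝ, 1 < s ∧ s ^ 2 = M :=
    ⟨√M, Real.lt_sqrt_of_sq_lt (by simpa using hM), Real.sq_sqrt (by linarith)⟩
  have hlog : 0 < Real.log s := Real.log_pos hs
  have hle : Real.log s ≤ s - 1 := Real.log_le_sub_one_of_pos (by linarith)
  have hxs : s ^ 2 < x * Real.log s := by
    rw [Real.log_pow, div_lt_iff₀ (by positivity)] at hx
    push_cast at hx
    linarith
  have hx0 : 0 < x := pos_of_mul_pos_left (lt_trans (by positivity) hxs) hlog.le
  have hsx : s < x := by nlinarith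
  exact hxs.trans (mul_lt_mul_of_pos_left (Real.log_lt_log (by linarith) hsx) hx0)

theorem le_pow_add_two_mul_add_of_mul_log_lt {n W V M : ℝ} (hn : 1 ≤ n) (hW : 0 < W)
    (hV : 0 ≤ V) (hM : 1 < M)
    (h : n * Real.log n < M / 4 + n * Real.log W + V * Real.log n) :
    n ≤ W ^ 4 + 2 * V + 2 * M / Real.log M := by
  by_contra! hlt
  have hMlog : 0 < 2 * M / Real.log M := div_pos (by linarith) (Real.log_pos hM)
  have hW4 : 0 < W ^ 4 := by positivity
  have hlogW : 4 * Real.log W ≤ Real.log n := by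
    have := Real.log_le_log hW4 (show W ^ 4 ≤ n by linarith)
    rwa [Real.log_pow] at this
  have hlogn : 0 ≤ Real.log n := Real.log_nonneg hn
  have h₁ : M < n * Real.log n := lt_mul_log_of_two_mul_div_log_lt hM (by linarith)
  have h₂ : n * (4 * Real.log W) ≤ n * Real.log n :=
    mul_le_mul_of_nonneg_left hlogW (by linarith)
  have h₃ : 2 * V * Real.log n ≤ n * Real.log n :=
    mul_le_mul_of_nonneg_right (by linarith) hlogn
  linarith



theorem statement12 (δ u v w H : ℝ) (hδ : δ ∈ Set.Ioo (0 : ℝ) 1) (hu : 1 ≤ u)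
    (hv : 0 ≤ v) (hw : 1 ≤ w) (hH : 3 ≤ H) (N : ℕ) (hN : 2 ≤ N)
    (h : ((N : ℝ) - 1) ^ ((N : ℝ) - 1)
        < (2 * u * H) ^ (1 / δ) * w ^ (((N : ℝ) - 1) / δ) * ((N : ℝ) - 1) ^ (v / δ)) :
    (N : ℝ) ≤ 1 + w ^ (4 / δ) + 2 * v / δ
        + 8 * Real.log (2 * u * H) / (δ * Real.log (Real.log ((2 * u * H) ^ (4 / δ)))) := by
  obtain ⟨hδ₀, hδ₁⟩ := hδ
  have hA : 6 ≤ 2 * u * H := by nlinarith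
  set A := 2 * u * H
  have hn : 1 ≤ (N : ℝ) - 1 := by
    have : (2 : ℝ) ≤ N := by exact_mod_cast hN
    linarith
  set n := (N : ℝ) - 1 with hn_def
  have hA₀ : 0 < A := by linarith
  have hn₀ : 0 < n := by linarith
  have hw₀ : 0 < w := by linarith
  have hlogA : 1 < Real.log A := by
    rw [Real.lt_log_iff_exp_lt hA₀]
    linarith [Real.exp_one_lt_three]
  have hM : 1 < 4 / δ * Real.log A := by
    have : 1 < 4 / δ := by rw [lt_div_iff₀ hδ₀]; linarith
    nlinarith
  have hlog := Real.log_lt_log (by positivity) h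
  rw [Real.log_mul (by positivity) (by positivity), Real.log_mul (by positivity) (by positivity),
    Real.log_rpow hn₀, Real.log_rpow hA₀, Real.log_rpow hw₀, Real.log_rpow hn₀] at hlog
  have key := le_pow_add_two_mul_add_of_mul_log_lt (W := w ^ (1 / δ)) (V := v / δ) hn
    (by positivity) (by positivity) hM (by
      rw [Real.log_rpow hw₀]
      convert hlog using 3 <;> ring)
  have hW : (w ^ (1 / δ)) ^ 4 = w ^ (4 / δ) := by
    rw [← Real.rpow_natCast, ← Real.rpow_mul hw₀.le]
    congr 1
    push_cast
    ring
  have hfrac : 8 * Real.log A / (δ * Real.log (4 / δ * Real.log A))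
      = 2 * (4 / δ * Real.log A) / Real.log (4 / δ * Real.log A) := by
    rw [← div_div]
    congr 1
    ring
  rw [Real.log_rpow hA₀, hfrac, ← hW, mul_div_assoc 2 v δ]
  linarith
end

section
/- For every real number y > e and every real number x ≥ 2·ln(y)/ln(ln(y)), one has x^x ≥ y. -/
theorem statement13 (y : ℝ) (hy : Real.exp 1 < y) (x : ℝ)
    (hx : 2 * Real.log y / Real.log (Real.log y) ≤ x) : y ≤ x ^ x := by
  have hy0 : 0 < y := (Real.exp_pos 1).trans hy
  have hL : 1 < Real.log y := (Real.lt_log_iff_exp_lt hy0).2 hy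
  have hM : 0 < Real.log (Real.log y) := Real.log_pos hL
  set L := Real.log y
  set M := Real.log L with hMdef
  have hq : 0 < 2 * L / M := by positivity
  have hx0 : 0 < x := hq.trans_le hx
  have hlog : M / 2 ≤ Real.log x := by
    have hmono : Real.log (2 * L / M) ≤ Real.log x := Real.log_le_log hq hx
    have hsplit : Real.log (2 * L / M) = M - Real.log (M / 2) := by
      rw [hMdef, ← Real.log_div (by positivity) (by positivity), ← hMdef]
      congr 1
      field_simp
    have hsub := Real.log_le_sub_one_of_pos (half_pos hM)
    linarith
  rw [← Real.log_le_log_iff hy0 (Real.rpow_pos_of_pos hx0 x), Real.log_rpow hx0]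
  calc L = 2 * L / M * (M / 2) := by field_simp
    _ ≤ x * Real.log x := by gcongr
end
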